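/- arXiv:1412.3303 — 5 statements merged into one kernel-verified Lean document; each statement's English description precedes it below -/
import Mathlib

section
/- Let (B₀,{-,-}) be a Poisson k-algebra, e : 0 → (t) → Ã → A → 0 a small extension, Λ an A-bilinear Poisson bracket (an A-bilinear antisymmetric biderivation satisfying the Jacobi identity) on B₀⊗ₖA inducing {-,-} on B₀, and Λ₁, Λ₂ two Ã-bilinear antisymmetric biderivations on B₀⊗ₖÃ both inducing Λ on B₀⊗ₖA. Let Λ' be an antisymmetric k-bilinear biderivation of B₀ with Λ₁(x⊗1, y⊗1) − Λ₂(x⊗1, y⊗1) = Λ'(x,y)⊗t for all x,y ∈ B₀. Then the assignment P ↦ θ_P, where θ_P is the Ã-linear endomorphism of B₀⊗ₖÃ determined by θ_P(x⊗1) = x⊗1 + P(x)⊗t, is a bijection from the set {P ∈ Der_k(B₀) : Λ'(x,y) = {P(x),y} + {x,P(y)} − P({x,y}) for all x,y ∈ B₀} onto the set of Ã-algebra isomorphisms θ : B₀⊗ₖÃ → B₀⊗ₖÃ satisfying θ(Λ₁(u,v)) = Λ₂(θ(u),θ(v)) for all u,v ∈ B₀⊗ₖÃ and inducing the identity on B₀⊗ₖA.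 -/
open scoped TensorProduct

/-- An antisymmetric `R`-bilinear biderivation on a commutative `R`-algebra `C`:
a map which is antisymmetric, `R`-bilinear, and a derivation in each argument. -/
def IsAntisymBiderivation (R : Type*) {C : Type*} [CommSemiring R] [CommRing C]
    [Algebra R C] (P : C → C → C) : Prop :=
  (∀ x y, P x y = - P y x) ∧
  (∀ (r : R) (x x' y : C), P (r • x + x') y = r • P x y + P x' y) ∧
  (∀ (r : R) (x y y' : C), P x (r • y + y') = r • P x y + P x y') ∧
  (∀ x x' y : C, P (x * x') y = x * P x' y + x' * P x y) ∧
  (∀ x y y' : C, P x (y * y') = y * P x y' + y' * P x y)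

/-- The Jacobi identity for a bracket. -/
def SatisfiesJacobi {C : Type*} [CommRing C] (P : C → C → C) : Prop :=
  ∀ x y z, P x (P y z) + P y (P z x) + P z (P x y) = 0

/-- A Poisson bracket over `R`: an antisymmetric `R`-bilinear biderivation
satisfying the Jacobi identity. -/
def IsPoissonBracket (R : Type*) {C : Type*} [CommSemiring R] [CommRing C]
    [Algebra R C] (P : C → C → C) : Prop :=
  IsAntisymBiderivation R P ∧ SatisfiesJacobi P

section SmallExtension

variable {k B₀ Atil : Type*} [Field k] [CommRing B₀] [Algebra k B₀] [CommRing Atil] [Algebra k Atil]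

namespace IsAntisymBiderivation

variable {R C : Type*} [CommRing R] [CommRing C] [Algebra R C] {P : C → C → C}

theorem map_add_left (h : IsAntisymBiderivation R P) (x x' y : C) :
    P (x + x') y = P x y + P x' y := by
  simpa using h.2.1 1 x x' y

theorem map_add_right (h : IsAntisymBiderivation R P) (x y y' : C) :
    P x (y + y') = P x y + P x y' := by
  simpa using h.2.2.1 1 x y y'

theorem map_zero_left (h : IsAntisymBiderivation R P) (y : C) : P 0 y = 0 := by
  simpa using h.map_add_left 0 0 y

theorem map_zero_right (h : IsAntisymBiderivation R P) (x : C) : P x 0 = 0 := by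
  simpa using h.map_add_right x 0 0

theorem map_smul_left (h : IsAntisymBiderivation R P) (r : R) (x y : C) :
    P (r • x) y = r • P x y := by
  simpa [h.map_zero_left] using h.2.1 r x 0 y

theorem map_smul_right (h : IsAntisymBiderivation R P) (r : R) (x y : C) :
    P x (r • y) = r • P x y := by
  simpa [h.map_zero_right] using h.2.2.1 r x y 0

end IsAntisymBiderivation

theorem mul_eq_smul_of_annihilated [IsLocalRing Atil] {ε : Atil →ₐ[k] k}
    (hε : RingHom.ker (ε : Atil →+* k) = IsLocalRing.maximalIdeal Atil) {t : Atil}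
    (htann : ∀ m ∈ IsLocalRing.maximalIdeal Atil, m * t = 0) (a : Atil) :
    a * t = ε a • t := by
  have hm : a - algebraMap k Atil (ε a) ∈ IsLocalRing.maximalIdeal Atil := by
    rw [← hε, RingHom.mem_ker]
    simp
  have h := htann _ hm
  rw [sub_mul, sub_eq_zero] at h
  rw [h, Algebra.smul_def]

theorem tmul_left_injective {t : Atil} (ht : t ≠ 0) :
    Function.Injective fun b : B₀ => t ⊗ₜ[k] b := by
  have hinj : Function.Injective (LinearMap.toSpanSingleton k Atil t) :=
    LinearMap.ker_eq_bot.mp (LinearMap.ker_toSpanSingleton k ht)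
  have h := Module.Flat.rTensor_preserves_injective_linearMap (M := B₀) _ hinj
  intro b c hbc
  have hone : (1 : k) ⊗ₜ[k] b = (1 : k) ⊗ₜ[k] c := h (by simpa using hbc)
  simpa using congrArg (TensorProduct.lid k B₀) hone

/-- If `(t)` is a one-dimensional ideal, the kernel of the reduction modulo `t` is `t ⊗ B₀`. -/
theorem exists_eq_tmul_of_map_eq_zero {ε : Atil →ₐ[k] k} {t : Atil}
    (ht : ∀ a, a * t = ε a • t)
    {π : (Atil ⊗[k] B₀) →ₐ[k] ((Atil ⧸ Ideal.span {t}) ⊗[k] B₀)}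
    (hπ : ∀ (a : Atil) (x : B₀), π (a ⊗ₜ x) = (Ideal.Quotient.mk (Ideal.span {t}) a) ⊗ₜ x)
    {u : Atil ⊗[k] B₀} (hu : π u = 0) : ∃ b : B₀, u = t ⊗ₜ b := by
  have hex : Function.Exact (LinearMap.toSpanSingleton k Atil t)
      (Ideal.Quotient.mkₐ k (Ideal.span {t})).toLinearMap := by
    intro a
    simp only [AlgHom.toLinearMap_apply, Ideal.Quotient.mkₐ_eq_mk, Ideal.Quotient.eq_zero_iff_mem,
      Ideal.mem_span_singleton', Set.mem_range, LinearMap.toSpanSingleton_apply]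
    constructor
    · rintro ⟨c, rfl⟩
      exact ⟨ε c, (ht c).symm⟩
    · rintro ⟨c, rfl⟩
      exact ⟨algebraMap k Atil c, (Algebra.smul_def c t).symm⟩
  have hsurj : Function.Surjective (Ideal.Quotient.mkₐ k (Ideal.span {t})).toLinearMap :=
    Ideal.Quotient.mkₐ_surjective k _
  have hπ' : π.toLinearMap =
      (Ideal.Quotient.mkₐ k (Ideal.span {t})).toLinearMap.rTensor B₀ := by
    apply TensorProduct.ext'
    intro a x
    simp [hπ]
  have hu' : (Ideal.Quotient.mkₐ k (Ideal.span {t})).toLinearMap.rTensor B₀ u = 0 := by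
    rw [← hπ']
    exact hu
  obtain ⟨w, rfl⟩ := (rTensor_exact B₀ hex hsurj u).mp hu'
  refine ⟨TensorProduct.lid k B₀ w, ?_⟩
  clear hu hu'
  induction w with
  | zero => simp
  | tmul c x => simp [TensorProduct.smul_tmul]
  | add w w' hw hw' => rw [map_add, map_add, TensorProduct.tmul_add, hw, hw']

variable {ε : Atil →ₐ[k] k} {t : Atil} (ht : ∀ a, a * t = ε a • t) (hεt : ε t = 0)
  {σ : (Atil ⊗[k] B₀) →ₐ[k] B₀} (hσ : ∀ (a : Atil) (x : B₀), σ (a ⊗ₜ x) = ε a • x)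

include ht hσ in
theorem mul_tmul_eq_tmul_map_mul (u : Atil ⊗[k] B₀) (b : B₀) :
    u * t ⊗ₜ b = t ⊗ₜ (σ u * b) := by
  induction u with
  | zero => simp
  | tmul a x => simp [ht, hσ, TensorProduct.smul_tmul]
  | add u v hu hv => rw [add_mul, hu, hv, map_add, add_mul, TensorProduct.tmul_add]

include ht in
theorem smul_tmul_eq_tmul_smul (a : Atil) (b : B₀) :
    a • (t ⊗ₜ[k] b) = t ⊗ₜ (ε a • b) := by
  rw [TensorProduct.smul_tmul', smul_eq_mul, ht, TensorProduct.smul_tmul]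

include ht hσ in
theorem smul_eq_tmul_map (u : Atil ⊗[k] B₀) : t • u = t ⊗ₜ σ u := by
  have h := mul_tmul_eq_tmul_map_mul ht hσ u 1
  rw [mul_one] at h
  rw [← h, mul_comm, Algebra.smul_def]
  rfl

/-- The automorphism `x ⊗ 1 ↦ x ⊗ 1 + P x ⊗ t` attached to a derivation `P`. -/
noncomputable def infinitesimalAut (P : Derivation k B₀ B₀) :
    (Atil ⊗[k] B₀) →ₐ[Atil] (Atil ⊗[k] B₀) where
  toFun u := u + t ⊗ₜ P (σ u)
  map_one' := by simp
  map_zero' := by simp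
  map_add' u v := by
    rw [map_add, map_add, TensorProduct.tmul_add]
    abel
  map_mul' u v := by
    have h (b c : B₀) : (t ⊗ₜ[k] b) * (t ⊗ₜ[k] c) = 0 := by
      rw [mul_tmul_eq_tmul_map_mul ht hσ, hσ, hεt]
      simp
    rw [mul_add, add_mul, add_mul, h, mul_tmul_eq_tmul_map_mul ht hσ,
      mul_comm (t ⊗ₜ[k] _) v, mul_tmul_eq_tmul_map_mul ht hσ, map_mul, Derivation.leibniz,
      TensorProduct.tmul_add, smul_eq_mul, smul_eq_mul]
    abel
  commutes' a := by
    rw [Algebra.TensorProduct.algebraMap_apply, hσ]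
    simp

theorem infinitesimalAut_apply (P : Derivation k B₀ B₀) (u : Atil ⊗[k] B₀) :
    infinitesimalAut ht hεt hσ P u = u + t ⊗ₜ P (σ u) := rfl

theorem infinitesimalAut_one_tmul (P : Derivation k B₀ B₀) (x : B₀) :
    infinitesimalAut ht hεt hσ P (1 ⊗ₜ x) = 1 ⊗ₜ x + t ⊗ₜ P x := by
  rw [infinitesimalAut_apply, hσ, map_one, one_smul]

theorem infinitesimalAut_neg_apply_apply (P : Derivation k B₀ B₀) (u : Atil ⊗[k] B₀) :
    infinitesimalAut ht hεt hσ (-P) (infinitesimalAut ht hεt hσ P u) = u := by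
  simp [infinitesimalAut_apply, hσ, hεt, TensorProduct.tmul_neg]

theorem infinitesimalAut_bijective (P : Derivation k B₀ B₀) :
    Function.Bijective (infinitesimalAut ht hεt hσ P) := by
  refine Function.bijective_iff_has_inverse.mpr ⟨infinitesimalAut ht hεt hσ (-P),
    infinitesimalAut_neg_apply_apply ht hεt hσ P, fun u => ?_⟩
  simpa using infinitesimalAut_neg_apply_apply ht hεt hσ (-P) u

/-- An algebra endomorphism of the form `x ⊗ 1 ↦ x ⊗ 1 + P x ⊗ t` comes from a derivation. -/
theorem exists_derivation_of_map_one_tmul (ht0 : t ≠ 0)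
    {θ : (Atil ⊗[k] B₀) →ₐ[Atil] (Atil ⊗[k] B₀)}
    (hθ : ∀ x : B₀, ∃ b : B₀, θ (1 ⊗ₜ x) = 1 ⊗ₜ x + t ⊗ₜ b) :
    ∃ P : Derivation k B₀ B₀, infinitesimalAut ht hεt hσ P = θ := by
  choose D hD using hθ
  have hinj := tmul_left_injective (k := k) (B₀ := B₀) ht0
  have hadd (x y : B₀) : D (x + y) = D x + D y := by
    apply hinj
    have h := hD (x + y)
    rw [TensorProduct.tmul_add, map_add, hD, hD] at h
    simp only [TensorProduct.tmul_add]
    linear_combination -h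
  have hsmul (c : k) (x : B₀) : D (c • x) = c • D x := by
    apply hinj
    have h := hD (c • x)
    have hc : (1 : Atil) ⊗ₜ[k] (c • x) = algebraMap k Atil c • ((1 : Atil) ⊗ₜ[k] x) := by
      rw [TensorProduct.tmul_smul, algebraMap_smul]
    rw [hc, map_smul, hD, smul_add, algebraMap_smul, algebraMap_smul,
      ← TensorProduct.tmul_smul, ← TensorProduct.tmul_smul] at h
    exact (add_left_cancel h).symm
  have hmul (x y : B₀) : D (x * y) = x • D y + y • D x := by
    apply hinj
    have h := hD (x * y)
    have hxy : (1 : Atil) ⊗ₜ[k] (x * y) = (1 ⊗ₜ x) * (1 ⊗ₜ y) := by simp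
    have h₁ := mul_tmul_eq_tmul_map_mul ht hσ (1 ⊗ₜ x) (D y)
    have h₂ := mul_tmul_eq_tmul_map_mul ht hσ (1 ⊗ₜ y) (D x)
    have h₃ := mul_tmul_eq_tmul_map_mul ht hσ (t ⊗ₜ D x) (D y)
    rw [hσ, map_one, one_smul] at h₁ h₂
    rw [hσ, hεt, zero_smul, zero_mul, TensorProduct.tmul_zero] at h₃
    rw [hxy, map_mul, hD, hD] at h
    simp only [TensorProduct.tmul_add, smul_eq_mul]
    linear_combination -h + h₁ + h₂ + h₃
  refine ⟨Derivation.mk' ⟨⟨D, hadd⟩, hsmul⟩ hmul, ?_⟩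
  apply Algebra.TensorProduct.ext'
  intro a x
  have ha : a ⊗ₜ[k] x = a • ((1 : Atil) ⊗ₜ[k] x) := by
    rw [TensorProduct.smul_tmul', smul_eq_mul, mul_one]
  rw [ha, map_smul, map_smul, infinitesimalAut_one_tmul, hD]
  rfl

variable {br Λ' : B₀ → B₀ → B₀} {Λ₁ Λ₂ : (Atil ⊗[k] B₀) → (Atil ⊗[k] B₀) → (Atil ⊗[k] B₀)}

include ht hσ in
theorem eq_add_tmul_of_one_tmul (hΛ₁ : IsAntisymBiderivation Atil Λ₁)
    (hΛ₂ : IsAntisymBiderivation Atil Λ₂) (hΛ' : IsAntisymBiderivation k Λ')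
    (hΛ't : ∀ x y : B₀, Λ₁ (1 ⊗ₜ x) (1 ⊗ₜ y) - Λ₂ (1 ⊗ₜ x) (1 ⊗ₜ y) = t ⊗ₜ Λ' x y)
    (u v : Atil ⊗[k] B₀) : Λ₁ u v = Λ₂ u v + t ⊗ₜ Λ' (σ u) (σ v) := by
  have ha (a : Atil) (x : B₀) : a ⊗ₜ[k] x = a • ((1 : Atil) ⊗ₜ[k] x) := by
    rw [TensorProduct.smul_tmul', smul_eq_mul, mul_one]
  induction u with
  | zero => simp [hΛ₁.map_zero_left, hΛ₂.map_zero_left, hΛ'.map_zero_left]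
  | add u u' hu hu' =>
    rw [hΛ₁.map_add_left, hΛ₂.map_add_left, map_add, hΛ'.map_add_left, hu, hu',
      TensorProduct.tmul_add]
    abel
  | tmul a x =>
    induction v with
    | zero => simp [hΛ₁.map_zero_right, hΛ₂.map_zero_right, hΛ'.map_zero_right]
    | add v v' hv hv' =>
      rw [hΛ₁.map_add_right, hΛ₂.map_add_right, map_add, hΛ'.map_add_right, hv, hv',
        TensorProduct.tmul_add]
      abel
    | tmul b y =>
      rw [hσ, hσ, ha a, ha b, hΛ₁.map_smul_left, hΛ₂.map_smul_left, hΛ₁.map_smul_right,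
        hΛ₂.map_smul_right, hΛ'.map_smul_left, hΛ'.map_smul_right,
        ← smul_tmul_eq_tmul_smul ht, ← smul_tmul_eq_tmul_smul ht, ← hΛ't]
      simp only [smul_sub]
      abel

include ht hσ in
theorem map_tmul_right (hΛ₂ : IsAntisymBiderivation Atil Λ₂)
    (hbr : ∀ u v, σ (Λ₂ u v) = br (σ u) (σ v)) (u : Atil ⊗[k] B₀) (b : B₀) :
    Λ₂ u (t ⊗ₜ b) = t ⊗ₜ br (σ u) b := by
  have hb : t ⊗ₜ[k] b = t • ((1 : Atil) ⊗ₜ[k] b) := by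
    rw [TensorProduct.smul_tmul', smul_eq_mul, mul_one]
  rw [hb, hΛ₂.map_smul_right, smul_eq_tmul_map ht hσ, hbr, hσ, map_one, one_smul]

include ht hσ in
theorem map_tmul_left (hΛ₂ : IsAntisymBiderivation Atil Λ₂)
    (hbr : ∀ u v, σ (Λ₂ u v) = br (σ u) (σ v)) (b : B₀) (v : Atil ⊗[k] B₀) :
    Λ₂ (t ⊗ₜ b) v = t ⊗ₜ br b (σ v) := by
  have hb : t ⊗ₜ[k] b = t • ((1 : Atil) ⊗ₜ[k] b) := by
    rw [TensorProduct.smul_tmul', smul_eq_mul, mul_one]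
  rw [hb, hΛ₂.map_smul_left, smul_eq_tmul_map ht hσ, hbr, hσ, map_one, one_smul]

/-- `infinitesimalAut` intertwines two lifts of a bracket exactly when their difference is the
coboundary of the derivation. -/
theorem infinitesimalAut_intertwines_iff (ht0 : t ≠ 0) (hbr₀ : IsAntisymBiderivation k br)
    (hΛ₁ : IsAntisymBiderivation Atil Λ₁) (hΛ₂ : IsAntisymBiderivation Atil Λ₂)
    (hΛ' : IsAntisymBiderivation k Λ')
    (hΛ't : ∀ x y : B₀, Λ₁ (1 ⊗ₜ x) (1 ⊗ₜ y) - Λ₂ (1 ⊗ₜ x) (1 ⊗ₜ y) = t ⊗ₜ Λ' x y)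
    (hbr₂ : ∀ u v, σ (Λ₂ u v) = br (σ u) (σ v))
    (P : Derivation k B₀ B₀) :
    (∀ u v, infinitesimalAut ht hεt hσ P (Λ₁ u v) =
        Λ₂ (infinitesimalAut ht hεt hσ P u) (infinitesimalAut ht hεt hσ P v)) ↔
      ∀ x y, Λ' x y = br (P x) y + br x (P y) - P (br x y) := by
  have key (u v : Atil ⊗[k] B₀) : infinitesimalAut ht hεt hσ P (Λ₁ u v) =
        Λ₂ (infinitesimalAut ht hεt hσ P u) (infinitesimalAut ht hεt hσ P v) ↔
      Λ' (σ u) (σ v) = br (P (σ u)) (σ v) + br (σ u) (P (σ v)) - P (br (σ u) (σ v)) := by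
    rw [← (tmul_left_injective (k := k) (B₀ := B₀) ht0).eq_iff]
    simp only [infinitesimalAut_apply, hΛ₂.map_add_left, hΛ₂.map_add_right,
      map_tmul_left ht hσ hΛ₂ hbr₂, map_tmul_right ht hσ hΛ₂ hbr₂, hσ, hεt, zero_smul, hbr₂,
      map_add, map_zero, add_zero, hbr₀.map_zero_right,
      eq_add_tmul_of_one_tmul ht hσ hΛ₁ hΛ₂ hΛ' hΛ't u v, TensorProduct.tmul_add,
      TensorProduct.tmul_sub, TensorProduct.tmul_zero]
    constructor <;> intro h <;> linear_combination h
  refine ⟨fun h x y => ?_, fun h u v => (key u v).mpr (h _ _)⟩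
  simpa [hσ] using (key (1 ⊗ₜ x) (1 ⊗ₜ y)).mp (h _ _)

end SmallExtension

/-- Lemma 3.1 of the paper: over a small extension `0 → (t) → Ã → A → 0`,
isomorphisms between two lifts `Λ₁`, `Λ₂` of a Poisson structure `Λ` on `B₀ ⊗ₖ A`
inducing the identity correspond bijectively, via `P ↦ (x ⊗ 1 ↦ x ⊗ 1 + P x ⊗ t)`, to
derivations `P` with `Λ' = [Λ₀, P]`, where `Λ₁ − Λ₂ = t·Λ'`. -/
theorem isomorphisms_of_lifted_Poisson_structures
    (k : Type*) [Field k] [IsAlgClosed k] [CharZero k]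
    (B₀ : Type*) [CommRing B₀] [Algebra k B₀]
    (br : B₀ → B₀ → B₀) (hbr : IsPoissonBracket k br)
    (Atil : Type*) [CommRing Atil] [Algebra k Atil] [IsLocalRing Atil] [IsArtinianRing Atil]
    (ε : Atil →ₐ[k] k)
    (hε : RingHom.ker (ε : Atil →+* k) = IsLocalRing.maximalIdeal Atil)
    (t : Atil) (ht0 : t ≠ 0) (htmem : t ∈ IsLocalRing.maximalIdeal Atil)
    (htann : ∀ m ∈ IsLocalRing.maximalIdeal Atil, m * t = 0)
    (εA : (Atil ⧸ Ideal.span {t}) →ₐ[k] k)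
    (hεA : εA.comp (Ideal.Quotient.mkₐ k (Ideal.span {t})) = ε)
    (π : (Atil ⊗[k] B₀) →ₐ[k] ((Atil ⧸ Ideal.span {t}) ⊗[k] B₀))
    (hπ : ∀ (a : Atil) (x : B₀), π (a ⊗ₜ x) = (Ideal.Quotient.mk (Ideal.span {t}) a) ⊗ₜ x)
    (ρ : ((Atil ⧸ Ideal.span {t}) ⊗[k] B₀) →ₐ[k] B₀)
    (hρ : ∀ (a : Atil ⧸ Ideal.span {t}) (x : B₀), ρ (a ⊗ₜ x) = εA a • x)
    (Λ : ((Atil ⧸ Ideal.span {t}) ⊗[k] B₀) → ((Atil ⧸ Ideal.span {t}) ⊗[k] B₀) →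
        ((Atil ⧸ Ideal.span {t}) ⊗[k] B₀))
    (hΛ : IsAntisymBiderivation (Atil ⧸ Ideal.span {t}) Λ)
    (hΛJ : SatisfiesJacobi Λ)
    (hΛbr : ∀ u v, ρ (Λ u v) = br (ρ u) (ρ v))
    (Λ₁ Λ₂ : (Atil ⊗[k] B₀) → (Atil ⊗[k] B₀) → (Atil ⊗[k] B₀))
    (hΛ₁ : IsAntisymBiderivation Atil Λ₁)
    (hΛ₂ : IsAntisymBiderivation Atil Λ₂)
    (hΛ₁π : ∀ u v, π (Λ₁ u v) = Λ (π u) (π v))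
    (hΛ₂π : ∀ u v, π (Λ₂ u v) = Λ (π u) (π v))
    (Λ' : B₀ → B₀ → B₀) (hΛ' : IsAntisymBiderivation k Λ')
    (hΛ't : ∀ x y : B₀,
        Λ₁ ((1 : Atil) ⊗ₜ x) ((1 : Atil) ⊗ₜ y) - Λ₂ ((1 : Atil) ⊗ₜ x) ((1 : Atil) ⊗ₜ y)
          = t ⊗ₜ Λ' x y) :
    ∃ e : {P : Derivation k B₀ B₀ //
            ∀ x y, Λ' x y = br (P x) y + br x (P y) - P (br x y)} ≃
          {θ : (Atil ⊗[k] B₀) →ₐ[Atil] (Atil ⊗[k] B₀) //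
            Function.Bijective θ ∧ (∀ u v, θ (Λ₁ u v) = Λ₂ (θ u) (θ v)) ∧
              ∀ u, π (θ u) = π u},
      ∀ (P : {P : Derivation k B₀ B₀ //
            ∀ x y, Λ' x y = br (P x) y + br x (P y) - P (br x y)}) (x : B₀),
        (e P).1 ((1 : Atil) ⊗ₜ x) = (1 : Atil) ⊗ₜ x + t ⊗ₜ (P.1 x) := by
  have ht := mul_eq_smul_of_annihilated hε htann
  have hεt : ε t = 0 := by
    rw [← hε, RingHom.mem_ker] at htmem
    exact htmem
  have hσ (a : Atil) (x : B₀) : (ρ.comp π) (a ⊗ₜ x) = ε a • x := by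
    rw [AlgHom.comp_apply, hπ, hρ, ← hεA]
    rfl
  have hiff := infinitesimalAut_intertwines_iff ht hεt hσ ht0 hbr.1 hΛ₁ hΛ₂ hΛ' hΛ't
    (fun u v => by simp only [AlgHom.comp_apply, hΛ₂π, hΛbr])
  have hπt (b : B₀) : π (t ⊗ₜ b) = 0 := by
    rw [hπ, Ideal.Quotient.eq_zero_iff_mem.mpr (Ideal.mem_span_singleton_self t),
      TensorProduct.zero_tmul]
  refine ⟨Equiv.ofBijective (fun P => ⟨infinitesimalAut ht hεt hσ P.1,
    infinitesimalAut_bijective ht hεt hσ P.1, (hiff P.1).mpr P.2, fun u => ?_⟩) ⟨?_, ?_⟩, ?_⟩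
  · rw [infinitesimalAut_apply, map_add, hπt, add_zero]
  · intro P Q hPQ
    ext x
    have h := DFunLike.congr_fun (congrArg Subtype.val hPQ) (1 ⊗ₜ x)
    simp only [infinitesimalAut_one_tmul] at h
    exact tmul_left_injective ht0 (add_left_cancel h)
  · rintro ⟨θ, hbij, hΛθ, hid⟩
    obtain ⟨P, rfl⟩ := exists_derivation_of_map_one_tmul ht hεt hσ ht0 (θ := θ) fun x => by
      obtain ⟨b, hb⟩ := exists_eq_tmul_of_map_eq_zero ht hπ
        (u := θ (1 ⊗ₜ x) - 1 ⊗ₜ x) (by rw [map_sub, hid, sub_self])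
      exact ⟨b, by rw [← hb, add_sub_cancel]⟩
    exact ⟨⟨P, (hiff P).mp hΛθ⟩, rfl⟩
  · intro P x
    exact infinitesimalAut_one_tmul ht hεt hσ P.1 x
end

section
/- Let B₀ be a commutative k-algebra with a k-derivation T₀, e : 0 → (t) → Ã → A → 0 a small extension, T an A-linear derivation of B₀⊗ₖA inducing T₀ on B₀, and T₁, T₂ two Ã-linear derivations of B₀⊗ₖÃ both inducing T on B₀⊗ₖA. Let T' be a k-derivation of B₀ with T₁(x⊗1) − T₂(x⊗1) = T'(x)⊗t for all x ∈ B₀. Then the assignment P ↦ θ_P, where θ_P is the Ã-linear endomorphism of B₀⊗ₖÃ with θ_P(x⊗1) = x⊗1 + P(x)⊗t, is a bijection from the set {P ∈ Der_k(B₀) : T' + P∘T₀ − T₀∘P = 0} onto the set of Ã-algebra isomorphisms θ of B₀⊗ₖÃ satisfying θ∘T₁ = T₂∘θ and inducing the identity on B₀⊗ₖA. -/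
open scoped TensorProduct

namespace SmallExtension

variable {k A B C : Type*} [Field k] [CommRing A] [Algebra k A] [CommRing B] [Algebra k B]
  [CommRing C] [Algebra A C] [Algebra k C]

/-- The `A`-algebra endomorphism `u ↦ u + ι (P (σ u))` attached to a `k`-derivation `P` of `B`,
where `σ : C → B` is a reduction map and `ι` embeds `B` as a square-zero ideal of `C`. -/
def perturbId (ε : A →ₐ[k] k) (σ : C →ₐ[k] B) (ι : B →ₗ[k] C)
    (hmul : ∀ u x, u * ι x = ι (σ u * x)) (hσι : ∀ x, σ (ι x) = 0)
    (hsmul : ∀ (a : A) x, a • ι x = ι (ε a • x)) (hσ : ∀ (a : A) u, σ (a • u) = ε a • σ u)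
    (P : Derivation k B B) : C →ₐ[A] C :=
  AlgHom.ofLinearMap
    { toFun := fun u => u + ι (P (σ u))
      map_add' := fun u v => by simp only [map_add]; abel
      map_smul' := fun a u => by
        simp only [hσ, RingHom.id_apply, smul_add, hsmul, Derivation.map_smul] }
    (by simp)
    (fun u v => by
      have h : ι (P (σ u)) * ι (P (σ v)) = 0 := by rw [hmul, hσι, zero_mul, map_zero]
      have h₁ : ι (σ u * P (σ v)) = u * ι (P (σ v)) := (hmul _ _).symm
      have h₂ : ι (σ v * P (σ u)) = v * ι (P (σ u)) := (hmul _ _).symm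
      simp only [LinearMap.coe_mk, AddHom.coe_mk, map_mul, Derivation.leibniz, smul_eq_mul,
        map_add, h₁, h₂]
      linear_combination -h)

theorem perturbId_apply (ε : A →ₐ[k] k) (σ : C →ₐ[k] B) (ι : B →ₗ[k] C)
    (hmul : ∀ u x, u * ι x = ι (σ u * x)) (hσι : ∀ x, σ (ι x) = 0)
    (hsmul : ∀ (a : A) x, a • ι x = ι (ε a • x)) (hσ : ∀ (a : A) u, σ (a • u) = ε a • σ u)
    (P : Derivation k B B) (u : C) :
    perturbId ε σ ι hmul hσι hsmul hσ P u = u + ι (P (σ u)) := rfl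

theorem perturbId_bijective (ε : A →ₐ[k] k) (σ : C →ₐ[k] B) (ι : B →ₗ[k] C)
    (hmul : ∀ u x, u * ι x = ι (σ u * x)) (hσι : ∀ x, σ (ι x) = 0)
    (hsmul : ∀ (a : A) x, a • ι x = ι (ε a • x)) (hσ : ∀ (a : A) u, σ (a • u) = ε a • σ u)
    (P : Derivation k B B) :
    Function.Bijective (perturbId ε σ ι hmul hσι hsmul hσ P) := by
  refine ⟨(injective_iff_map_eq_zero _).2 fun u hu => ?_, fun u => ⟨u - ι (P (σ u)), ?_⟩⟩
  · rw [perturbId_apply] at hu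
    have h : σ u = 0 := by simpa [hσι] using congrArg σ hu
    simpa [h] using hu
  · simp [perturbId_apply, hσι]

/-- A `k`-algebra map `s + ι ∘ f`, with `s` an algebra map splitting `σ`,
makes `f` a derivation. -/
def derivationOfPerturbation (σ : C →ₐ[k] B) (ι : B →ₗ[k] C) (hι : Function.Injective ι)
    (hmul : ∀ u x, u * ι x = ι (σ u * x)) (hσι : ∀ x, σ (ι x) = 0)
    (s θ : B →ₐ[k] C) (hs : ∀ x, σ (s x) = x) (f : B → B)
    (hf : ∀ x, θ x = s x + ι (f x)) : Derivation k B B :=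
  Derivation.mk'
    { toFun := f
      map_add' := fun x y => hι (by
        have h := hf (x + y)
        rw [map_add, map_add, hf x, hf y] at h
        rw [map_add]
        linear_combination -h)
      map_smul' := fun c x => hι (by
        have h := hf (c • x)
        rw [map_smul, map_smul, hf x, smul_add] at h
        rw [RingHom.id_apply, map_smul]
        exact (add_left_cancel h).symm) }
    (fun x y => hι (by
      have h := hf (x * y)
      rw [map_mul, map_mul, hf x, hf y] at h
      have h₀ : ι (f x) * ι (f y) = 0 := by rw [hmul, hσι, zero_mul, map_zero]
      have h₁ : s x * ι (f y) = ι (x * f y) := by rw [hmul, hs]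
      have h₂ : s y * ι (f x) = ι (y * f x) := by rw [hmul, hs]
      simp only [LinearMap.coe_mk, AddHom.coe_mk, smul_eq_mul, map_add, ← h₁, ← h₂]
      linear_combination h₀ - h))

theorem tmul_injective {t : A} (ht : t ≠ 0) :
    Function.Injective (TensorProduct.mk k A B t) := by
  have h : Function.Injective (LinearMap.toSpanSingleton k A t) := by
    rw [← LinearMap.ker_eq_bot]
    exact LinearMap.ker_toSpanSingleton k ht
  have h' := Module.Flat.rTensor_preserves_injective_linearMap (M := B) _ h
  intro x y hxy
  have := @h' (1 ⊗ₜ x) (1 ⊗ₜ y) (by simpa using hxy)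
  simpa using congrArg (TensorProduct.lid k B) this

theorem exists_eq_tmul_of_mk_eq_zero (ε : A →ₐ[k] k) {t : A} (ht : ∀ a, a * t = ε a • t)
    (π : (A ⊗[k] B) →ₐ[k] ((A ⧸ Ideal.span {t}) ⊗[k] B))
    (hπ : ∀ (a : A) (x : B), π (a ⊗ₜ x) = (Ideal.Quotient.mk (Ideal.span {t}) a) ⊗ₜ x)
    {u : A ⊗[k] B} (hu : π u = 0) : ∃ x : B, u = t ⊗ₜ x := by
  have hex : Function.Exact (LinearMap.toSpanSingleton k A t)
      (Ideal.Quotient.mkₐ k (Ideal.span {t})).toLinearMap := by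
    intro a
    simp only [AlgHom.toLinearMap_apply, Ideal.Quotient.mkₐ_eq_mk, Ideal.Quotient.eq_zero_iff_mem,
      Ideal.mem_span_singleton', Set.mem_range, LinearMap.toSpanSingleton_apply]
    constructor
    · rintro ⟨b, rfl⟩
      exact ⟨ε b, (ht b).symm⟩
    · rintro ⟨c, rfl⟩
      exact ⟨algebraMap k A c, (Algebra.smul_def c t).symm⟩
  have hex' := rTensor_exact B hex Ideal.Quotient.mk_surjective
  have hπ' : π.toLinearMap =
      (Ideal.Quotient.mkₐ k (Ideal.span {t})).toLinearMap.rTensor B := by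
    ext a x
    simp [hπ]
  obtain ⟨w, rfl⟩ := (hex' u).1 (by rw [← hπ']; exact hu)
  obtain ⟨x, rfl⟩ := (TensorProduct.lid k B).symm.surjective w
  exact ⟨x, by simp⟩

end SmallExtension

open SmallExtension

/-- Lemma 3.2 of the paper: over a small extension, isomorphisms between
two lifts `T₁`, `T₂` of a derivation `T` on `B₀ ⊗ₖ A` inducing the identity correspond
bijectively, via `P ↦ (x ⊗ 1 ↦ x ⊗ 1 + P x ⊗ t)`, to derivations `P` with
`T' + [P, T₀] = 0`, where `T₁ − T₂ = t·T'`. -/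
theorem isomorphisms_of_lifted_derivations
    (k : Type*) [Field k] [IsAlgClosed k] [CharZero k]
    (B₀ : Type*) [CommRing B₀] [Algebra k B₀]
    (T₀ : Derivation k B₀ B₀)
    (Atil : Type*) [CommRing Atil] [Algebra k Atil] [IsLocalRing Atil] [IsArtinianRing Atil]
    (ε : Atil →ₐ[k] k)
    (hε : RingHom.ker (ε : Atil →+* k) = IsLocalRing.maximalIdeal Atil)
    (t : Atil) (ht0 : t ≠ 0) (htmem : t ∈ IsLocalRing.maximalIdeal Atil)
    (htann : ∀ m ∈ IsLocalRing.maximalIdeal Atil, m * t = 0)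
    (εA : (Atil ⧸ Ideal.span {t}) →ₐ[k] k)
    (hεA : εA.comp (Ideal.Quotient.mkₐ k (Ideal.span {t})) = ε)
    (π : (Atil ⊗[k] B₀) →ₐ[k] ((Atil ⧸ Ideal.span {t}) ⊗[k] B₀))
    (hπ : ∀ (a : Atil) (x : B₀), π (a ⊗ₜ x) = (Ideal.Quotient.mk (Ideal.span {t}) a) ⊗ₜ x)
    (ρ : ((Atil ⧸ Ideal.span {t}) ⊗[k] B₀) →ₐ[k] B₀)
    (hρ : ∀ (a : Atil ⧸ Ideal.span {t}) (x : B₀), ρ (a ⊗ₜ x) = εA a • x)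
    (T : Derivation (Atil ⧸ Ideal.span {t}) ((Atil ⧸ Ideal.span {t}) ⊗[k] B₀)
        ((Atil ⧸ Ideal.span {t}) ⊗[k] B₀))
    (hT : ∀ u, ρ (T u) = T₀ (ρ u))
    (T₁ T₂ : Derivation Atil (Atil ⊗[k] B₀) (Atil ⊗[k] B₀))
    (hT₁ : ∀ u, π (T₁ u) = T (π u))
    (hT₂ : ∀ u, π (T₂ u) = T (π u))
    (T' : Derivation k B₀ B₀)
    (hT' : ∀ x : B₀, T₁ ((1 : Atil) ⊗ₜ x) - T₂ ((1 : Atil) ⊗ₜ x) = t ⊗ₜ T' x) :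
    ∃ e : {P : Derivation k B₀ B₀ // ∀ x : B₀, T' x + P (T₀ x) - T₀ (P x) = 0} ≃
          {θ : (Atil ⊗[k] B₀) →ₐ[Atil] (Atil ⊗[k] B₀) //
            Function.Bijective θ ∧ (∀ u, θ (T₁ u) = T₂ (θ u)) ∧ ∀ u, π (θ u) = π u},
      ∀ (P : {P : Derivation k B₀ B₀ // ∀ x : B₀, T' x + P (T₀ x) - T₀ (P x) = 0})
        (x : B₀),
        (e P).1 ((1 : Atil) ⊗ₜ x) = (1 : Atil) ⊗ₜ x + t ⊗ₜ (P.1 x) := by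
  have htε : ∀ a, a * t = ε a • t := fun a => by
    have h : a - algebraMap k Atil (ε a) ∈ IsLocalRing.maximalIdeal Atil := by
      rw [← hε, RingHom.mem_ker]
      simp
    have h' := htann _ h
    rw [sub_mul, sub_eq_zero, ← Algebra.smul_def] at h'
    exact h'
  have hεt : ε t = 0 := by
    rw [← hε] at htmem
    exact htmem
  let σ : (Atil ⊗[k] B₀) →ₐ[k] B₀ := ρ.comp π
  let ι : B₀ →ₗ[k] (Atil ⊗[k] B₀) := TensorProduct.mk k Atil B₀ t
  have hι : Function.Injective ι := tmul_injective ht0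
  have hσt : ∀ (a : Atil) (x : B₀), σ (a ⊗ₜ x) = ε a • x := fun a x => by
    change ρ (π (a ⊗ₜ x)) = _
    rw [hπ, hρ, ← hεA]
    rfl
  have hσρ : ∀ u, ρ (π u) = σ u := fun _ => rfl
  have hιt : ∀ x, ι x = t ⊗ₜ x := fun _ => rfl
  have hσι : ∀ x, σ (ι x) = 0 := fun x => by rw [hιt, hσt, hεt, zero_smul]
  have hπι : ∀ x, π (ι x) = 0 := fun x => by
    rw [hιt, hπ, Ideal.Quotient.eq_zero_iff_mem.2 (Ideal.mem_span_singleton_self t),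
      TensorProduct.zero_tmul]
  have hmul : ∀ u x, u * ι x = ι (σ u * x) := fun u x => by
    induction u using TensorProduct.induction_on with
    | zero => simp
    | add u v hu hv => rw [add_mul, hu, hv, map_add, add_mul, map_add]
    | tmul a y =>
      rw [hσt, hιt, hιt, Algebra.TensorProduct.tmul_mul_tmul, htε, TensorProduct.smul_tmul,
        smul_mul_assoc]
  have hsmul : ∀ (a : Atil) x, a • ι x = ι (ε a • x) := fun a x => by
    rw [hιt, hιt, TensorProduct.smul_tmul', smul_eq_mul, htε, TensorProduct.smul_tmul]
  have hσ : ∀ (a : Atil) u, σ (a • u) = ε a • σ u := fun a u => by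
    rw [Algebra.smul_def, map_mul, Algebra.TensorProduct.algebraMap_apply, hσt]
    simp
  have htσ : ∀ u, t • u = ι (σ u) := fun u => by
    have h := hmul u 1
    rw [mul_one] at h
    rw [← h, hιt, Algebra.smul_def, mul_comm, Algebra.TensorProduct.algebraMap_apply]
    simp
  have hσT : ∀ S : Derivation Atil (Atil ⊗[k] B₀) (Atil ⊗[k] B₀),
      (∀ u, π (S u) = T (π u)) → ∀ u, σ (S u) = T₀ (σ u) := fun S hS u => by
    rw [← hσρ, hS, hT, hσρ]
  have hT₂ι : ∀ y, T₂ (ι y) = ι (T₀ y) := fun y => by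
    have h : ι y = t • ((1 : Atil) ⊗ₜ[k] y) := by
      rw [hιt, TensorProduct.smul_tmul', smul_eq_mul, mul_one]
    rw [h, Derivation.map_smul, htσ, hσT T₂ hT₂, hσt, map_one, one_smul]
  have hTT : ∀ u, T₁ u = T₂ u + ι (T' (σ u)) := fun u => by
    induction u using TensorProduct.induction_on with
    | zero => simp
    | add u v hu hv => simp only [map_add, hu, hv]; abel
    | tmul a x =>
      have h : a ⊗ₜ[k] x = a • ((1 : Atil) ⊗ₜ[k] x) := by
        rw [TensorProduct.smul_tmul', smul_eq_mul, mul_one]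
      rw [h, Derivation.map_smul, Derivation.map_smul, hσ, Derivation.map_smul, ← hsmul,
        ← smul_add, hσt, map_one, one_smul, hιt, ← hT', add_sub_cancel]
  let Θ := perturbId ε σ ι hmul hσι hsmul hσ
  have hΘ : ∀ P u, Θ P u = u + ι (P (σ u)) := fun _ _ => rfl
  have hcomm : ∀ P u, Θ P (T₁ u) - T₂ (Θ P u) =
      ι (T' (σ u) + P (T₀ (σ u)) - T₀ (P (σ u))) := fun P u => by
    rw [hΘ, hΘ, hσT T₁ hT₁, map_add, hT₂ι, hTT, map_sub, map_add]
    abel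
  have hπΘ : ∀ P u, π (Θ P u) = π u := fun P u => by rw [hΘ, map_add, hπι, add_zero]
  refine ⟨Equiv.ofBijective
    (fun P => ⟨Θ P.1, perturbId_bijective ε σ ι hmul hσι hsmul hσ P.1,
      fun u => sub_eq_zero.1 (by rw [hcomm, P.2, map_zero]), hπΘ P.1⟩) ⟨?_, ?_⟩, ?_⟩
  · rintro ⟨P, hP⟩ ⟨Q, hQ⟩ h
    have h' : Θ P = Θ Q := congrArg Subtype.val h
    refine Subtype.ext (Derivation.ext fun x => hι ?_)
    have hx := DFunLike.congr_fun h' ((1 : Atil) ⊗ₜ[k] x)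
    rw [hΘ, hΘ, hσt, map_one, one_smul] at hx
    exact add_left_cancel hx
  · rintro ⟨θ, -, hθ, hθπ⟩
    have hex : ∀ x : B₀, ∃ y, θ ((1 : Atil) ⊗ₜ x) - (1 : Atil) ⊗ₜ x = t ⊗ₜ[k] y := fun x =>
      exists_eq_tmul_of_mk_eq_zero ε htε π hπ (by rw [map_sub, hθπ, sub_self])
    choose f hf using hex
    let s : B₀ →ₐ[k] Atil ⊗[k] B₀ := Algebra.TensorProduct.includeRight
    let P : Derivation k B₀ B₀ := derivationOfPerturbation σ ι hι hmul hσι s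
      ((θ.restrictScalars k).comp s)
      (fun x => (hσt 1 x).trans (by rw [map_one, one_smul])) f
      (fun x => (sub_eq_iff_eq_add'.1 (hf x)))
    have hΘθ : Θ P = θ := by
      refine Algebra.TensorProduct.ext (by ext) (AlgHom.ext fun x => ?_)
      change Θ P ((1 : Atil) ⊗ₜ x) = θ ((1 : Atil) ⊗ₜ x)
      rw [hΘ, hσt, map_one, one_smul]
      exact (sub_eq_iff_eq_add'.1 (hf x)).symm
    refine ⟨⟨P, fun x => hι ?_⟩, Subtype.ext hΘθ⟩
    have h := hcomm P ((1 : Atil) ⊗ₜ x)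
    rw [hΘθ, hθ, sub_self, hσt, map_one, one_smul] at h
    rw [← h, map_zero]
  · intro P x
    change Θ P.1 _ = _
    rw [hΘ, hσt, map_one, one_smul, hιt]
end

section
/- Let (A,{-,-}) be a Poisson k-algebra, viewed as a module over itself. For every k-derivation T of A the map β_T(f,g) := {f,g} + g·T(f) is a Poisson connection on the A-module A; every Poisson connection β on the A-module A equals β_T for the unique k-derivation T(f) = β(f,1); and β_T is flat if and only if T is a Poisson derivation. Consequently T ↦ β_T is a bijection from the set of Poisson k-derivations of A onto the set of flat Poisson connections on the A-module A. -/
open scoped TensorProduct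

/-- A Poisson connection on an `A`-module `F`, for a bracket `br` on the
Poisson `k`-algebra `A`: a `k`-bilinear map `β : A → F → F` which is a derivation in the
first argument and satisfies the Leibniz identity `β f (g • s) = br f g • s + g • β f s`. -/
def IsPoissonConnection (k A F : Type*) [CommRing k] [CommRing A] [Algebra k A]
    [AddCommGroup F] [Module A F] (br : A → A → A) (β : A → F → F) : Prop :=
  (∀ f f' s, β (f + f') s = β f s + β f' s) ∧
  (∀ (c : k) (f : A) (s : F), β (algebraMap k A c * f) s = algebraMap k A c • β f s) ∧
  (∀ (f : A) (s s' : F), β f (s + s') = β f s + β f s') ∧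
  (∀ (c : k) (f : A) (s : F), β f (algebraMap k A c • s) = algebraMap k A c • β f s) ∧
  (∀ f f' s, β (f * f') s = f • β f' s + f' • β f s) ∧
  (∀ (f g : A) (s : F), β f (g • s) = br f g • s + g • β f s)

/-- Flatness of a Poisson connection. -/
def IsFlatConnection {A F : Type*} [CommRing A] [AddCommGroup F] [Module A F]
    (br : A → A → A) (β : A → F → F) : Prop :=
  ∀ f g s, β f (β g s) = β (br f g) s + β g (β f s)

section BracketConnection

variable {k A : Type*} [CommRing k] [CommRing A] [Algebra k A] {br : A → A → A}

theorem IsPoissonBracket.isPoissonConnection_add_derivation (hbr : IsPoissonBracket k br)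
    (T : Derivation k A A) :
    IsPoissonConnection k A A br (fun f s => br f s + s * T f) := by
  obtain ⟨⟨-, hl, hr, hml, hmr⟩, -⟩ := hbr
  have add_left (x x' y : A) : br (x + x') y = br x y + br x' y := by
    simpa using hl 1 x x' y
  have add_right (x y y' : A) : br x (y + y') = br x y + br x y' := by
    simpa using hr 1 x y y'
  have zero_left (y : A) : br 0 y = 0 := by simpa using add_left 0 0 y
  have zero_right (x : A) : br x 0 = 0 := by simpa using add_right x 0 0
  have smul_left (c : k) (x y : A) : br (c • x) y = c • br x y := by
    simpa [zero_left] using hl c x 0 y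
  have smul_right (c : k) (x y : A) : br x (c • y) = c • br x y := by
    simpa [zero_right] using hr c x y 0
  refine ⟨fun f f' s => ?_, fun c f s => ?_, fun f s s' => ?_, fun c f s => ?_,
    fun f f' s => ?_, fun f g s => ?_⟩
  · simp only [add_left, map_add]; ring
  · simp only [← Algebra.smul_def, smul_left, Derivation.map_smul, algebraMap_smul, smul_add,
      mul_smul_comm]
  · simp only [add_right]; ring
  · simp only [algebraMap_smul, smul_right, smul_add, smul_mul_assoc]
  · simp only [hml, Derivation.leibniz, smul_eq_mul]; ring
  · simp only [hmr, smul_eq_mul]; ring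

/-- The derivation `f ↦ β f 1` of a Poisson connection `β` on the module `A`. -/
def IsPoissonConnection.derivation {β : A → A → A} (hβ : IsPoissonConnection k A A br β) :
    Derivation k A A :=
  Derivation.mk'
    { toFun := fun f => β f 1
      map_add' := fun f f' => hβ.1 f f' 1
      map_smul' := fun c f => by
        simpa [Algebra.smul_def] using hβ.2.1 c f 1 }
    fun f f' => hβ.2.2.2.2.1 f f' 1

theorem IsPoissonConnection.derivation_apply {β : A → A → A}
    (hβ : IsPoissonConnection k A A br β) (f : A) : hβ.derivation f = β f 1 :=
  rfl

theorem IsPoissonConnection.eq_bracket_add_derivation {β : A → A → A}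
    (hβ : IsPoissonConnection k A A br β) (f s : A) :
    β f s = br f s + s * hβ.derivation f := by
  simpa [hβ.derivation_apply] using hβ.2.2.2.2.2 f s 1

theorem IsPoissonBracket.apply_one (hbr : IsPoissonBracket k br) (f : A) : br f 1 = 0 := by
  simpa using hbr.1.2.2.2.2 f 1 1

theorem IsPoissonBracket.isFlatConnection_add_derivation_iff (hbr : IsPoissonBracket k br)
    (T : Derivation k A A) :
    IsFlatConnection br (fun f s => br f s + s * T f) ↔
      ∀ f g, T (br f g) = br (T f) g + br f (T g) := by
  have apply_one := hbr.apply_one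
  obtain ⟨⟨hanti, -, hr, -, hmr⟩, hjac⟩ := hbr
  have add_right (x y y' : A) : br x (y + y') = br x y + br x y' := by
    simpa using hr 1 x y y'
  have neg_right (x y : A) : br x (-y) = - br x y := by
    have hzero : br x 0 = 0 := by simpa using add_right x 0 0
    have h := add_right x y (-y)
    rw [add_neg_cancel, hzero] at h
    linear_combination -h
  constructor
  · intro h f g
    have h1 := h f g 1
    simp only [apply_one, one_mul, zero_add] at h1
    linear_combination -h1 - hanti (T f) g
  · intro h f g s
    have hj := hjac f g s
    rw [hanti s f, neg_right, hanti s (br f g)] at hj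
    simp only [add_right, hmr]
    linear_combination hj - s * h f g - s * hanti (T f) g

end BracketConnection

/-- flat Poisson connections on the module `A` correspond to
Poisson derivations, via `T ↦ β_T` with `β_T f s = {f,s} + s·T f`. -/
theorem connections_on_A_are_brackets_plus_derivations
    (k A : Type*) [Field k] [IsAlgClosed k] [CharZero k]
    [CommRing A] [Algebra k A]
    (br : A → A → A) (hbr : IsPoissonBracket k br) :
    (∀ T : Derivation k A A,
        IsPoissonConnection k A A br (fun f s => br f s + s * T f)) ∧
    (∀ β : A → A → A, IsPoissonConnection k A A br β →
        ∃ T : Derivation k A A, (∀ f, T f = β f 1) ∧ ∀ f s, β f s = br f s + s * T f) ∧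
    (∀ T : Derivation k A A,
        IsFlatConnection br (fun f s => br f s + s * T f) ↔
          ∀ f g, T (br f g) = br (T f) g + br f (T g)) ∧
    (∃ e : {T : Derivation k A A // ∀ f g, T (br f g) = br (T f) g + br f (T g)} ≃
          {β : A → A → A // IsPoissonConnection k A A br β ∧ IsFlatConnection br β},
      ∀ T (f s : A), (e T).1 f s = br f s + s * T.1 f) := by
  refine ⟨hbr.isPoissonConnection_add_derivation,
    fun β hβ => ⟨hβ.derivation, hβ.derivation_apply, hβ.eq_bracket_add_derivation⟩,
    hbr.isFlatConnection_add_derivation_iff, ?_⟩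
  refine ⟨{
    toFun := fun T => ⟨fun f s => br f s + s * T.1 f,
      hbr.isPoissonConnection_add_derivation T.1,
      (hbr.isFlatConnection_add_derivation_iff T.1).2 T.2⟩
    invFun := fun β => ⟨β.2.1.derivation,
      (hbr.isFlatConnection_add_derivation_iff _).1 fun f g s => by
        simpa only [← β.2.1.eq_bracket_add_derivation] using β.2.2 f g s⟩
    left_inv := fun T => Subtype.ext <| Derivation.ext fun f => by
      simp [IsPoissonConnection.derivation_apply, hbr.apply_one]
    right_inv := fun β => Subtype.ext <| funext₂ fun f s =>
      (β.2.1.eq_bracket_add_derivation f s).symm }, fun T f s => rfl⟩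
end

section
/- Let (A,{-,-}) be a Poisson k-algebra, T and T' Poisson k-derivations of A, and let β, β' be the flat Poisson connections on the A-module A defined by β(f,s) = {f,s} + s·T(f) and β'(f,s) = {f,s} + s·T'(f). For a unit b ∈ Aˣ, the multiplication map μ_b : A → A, x ↦ b·x, satisfies μ_b(β'(f,x)) = β(f, μ_b(x)) for all f,x ∈ A if and only if b·(T'(f) − T(f)) = {f,b} for all f ∈ A. -/
open scoped TensorProduct

/-- for flat Poisson connections `β f s = {f,s} + s·T f` and
`β' f s = {f,s} + s·T' f` on the module `A`, multiplication by a unit `b` is a morphism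
of Poisson modules `(A,β') → (A,β)` iff `b·(T' f − T f) = {f,b}` for all `f`. -/
theorem unit_multiplication_is_Poisson_module_map_iff
    (k A : Type*) [Field k] [IsAlgClosed k] [CharZero k]
    [CommRing A] [Algebra k A]
    (br : A → A → A) (hbr : IsPoissonBracket k br)
    (T T' : Derivation k A A)
    (hT : ∀ f g, T (br f g) = br (T f) g + br f (T g))
    (hT' : ∀ f g, T' (br f g) = br (T' f) g + br f (T' g))
    (b : Aˣ) :
    (∀ f x : A, (b : A) * (br f x + x * T' f) = br f ((b : A) * x) + ((b : A) * x) * T f) ↔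
      ∀ f : A, (b : A) * (T' f - T f) = br f (b : A) := by
  obtain ⟨⟨-, -, -, -, hleib⟩, -⟩ := hbr
  have key (f x : A) :
      (b : A) * (br f x + x * T' f) - (br f (b * x) + (b * x) * T f) =
        x * ((b : A) * (T' f - T f) - br f b) := by
    rw [hleib]
    ring
  constructor
  · intro h f
    have := key f 1
    rwa [sub_eq_zero.mpr (h f 1), one_mul, eq_comm, sub_eq_zero] at this
  · intro h f x
    rw [← sub_eq_zero, key, h, sub_self, mul_zero]
end

section
/- Let (A,{-,-}) be a Poisson k-algebra and (T_{ij}), (W_{ij}) two n×n matrices of k-derivations of A. Extend the bracket {-,-} and all derivations k[ε]-bilinearly (respectively k[ε]-linearly) to A⊗ₖk[ε], where ε² = 0, and let {-,-}_F be the Poisson connection on (A⊗ₖk[ε])ⁿ given by ({f,s}_F)_i = {f,s_i} + Σ_j (T_{ij} + εW_{ij})(f)·s_j. Then {-,-}_F is flat if and only if both of the following hold for all i,j ∈ {1,…,n} and all f,g ∈ A: (a) {T_{ij}(f),g} + {f,T_{ij}(g)} − T_{ij}({f,g}) + Σ_k (T_{ik}(f)·T_{kj}(g) − T_{ik}(g)·T_{kj}(f))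 = 0; (b) {W_{ij}(f),g} + {f,W_{ij}(g)} − W_{ij}({f,g}) + Σ_k (T_{ik}(f)·W_{kj}(g) − T_{ik}(g)·W_{kj}(f) + W_{ik}(f)·T_{kj}(g) − W_{ik}(g)·T_{kj}(f)) = 0. -/
open scoped TensorProduct

/-- The curvature coefficients of the connection `s ↦ P f (s i) + ∑ j, D i j f * s j`. -/
def connectionCurvature {C ι : Type*} [CommRing C] [Fintype ι]
    (P : C → C → C) (D : ι → ι → C → C) (i j : ι) (f g : C) : C :=
  P (D i j f) g + P f (D i j g) - D i j (P f g) +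
    ∑ p, (D i p f * D p j g - D i p g * D p j f)

theorem isFlatConnection_iff_connectionCurvature_eq_zero {R C ι : Type*} [CommSemiring R]
    [CommRing C] [Algebra R C] [Fintype ι] {P : C → C → C} (hP : IsPoissonBracket R P)
    (D : ι → ι → C → C) :
    IsFlatConnection P (fun f (s : ι → C) i => P f (s i) + ∑ j, D i j f * s j) ↔
      ∀ i j f g, connectionCurvature P D i j f g = 0 := by
  classical
  obtain ⟨⟨anti, -, lin, -, leib⟩, jac⟩ := hP
  have padd (x y z : C) : P x (y + z) = P x y + P x z := by simpa using lin 1 x y z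
  have psum (x : C) (t : ι → C) : P x (∑ j, t j) = ∑ j, P x (t j) :=
    map_sum (AddMonoidHom.mk' (P x) (padd x)) t Finset.univ
  have pneg (x y : C) : P x (-y) = -P x y :=
    map_neg (AddMonoidHom.mk' (P x) (padd x)) y
  have key (f g : C) (s : ι → C) (i : ι) :
      P f (P g (s i) + ∑ j, D i j g * s j) +
          ∑ j, D i j f * (P g (s j) + ∑ l, D j l g * s l) -
        ((P (P f g) (s i) + ∑ j, D i j (P f g) * s j) +
          (P g (P f (s i) + ∑ j, D i j f * s j) +
            ∑ j, D i j g * (P f (s j) + ∑ l, D j l f * s l))) =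
      ∑ j, connectionCurvature P D i j f g * s j := by
    have comp (x y : C) : ∑ j, D i j x * ∑ l, D j l y * s l =
        ∑ j, (∑ p, D i p x * D p j y) * s j := by
      simp only [Finset.mul_sum, Finset.sum_mul]
      rw [Finset.sum_comm]
      simp only [mul_assoc]
    have hj := jac f g (s i)
    rw [anti (s i) f, pneg, anti (s i) (P f g)] at hj
    simp only [connectionCurvature, padd, psum, leib, mul_add, add_mul, sub_mul,
      Finset.sum_add_distrib, Finset.sum_sub_distrib, comp, anti (D i _ f) g, neg_mul,
      Finset.sum_neg_distrib]
    simp only [mul_comm (s _)]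
    linear_combination hj
  constructor
  · intro h i j f g
    have hs := congrFun (h f g (Pi.single j 1)) i
    have hk := key f g (Pi.single j 1) i
    simp only [Pi.add_apply] at hs
    rw [sub_eq_zero.mpr hs] at hk
    simpa [Pi.single_apply] using hk.symm
  · intro h f g s
    funext i
    have hk := key f g s i
    simp only [h, zero_mul, Finset.sum_const_zero] at hk
    exact sub_eq_zero.mp hk

/-- The `k[ε]`-bilinear extension of a bracket to the dual numbers. -/
def dualNumberBracket {A : Type*} [CommRing A] (br : A → A → A) (u v : DualNumber A) :
    DualNumber A :=
  TrivSqZeroExt.inl (br u.fst v.fst) + TrivSqZeroExt.inr (br u.fst v.snd + br u.snd v.fst)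

theorem IsPoissonBracket.dualNumberBracket {R A : Type*} [CommSemiring R] [CommRing A]
    [Algebra R A] {br : A → A → A} (h : IsPoissonBracket R br) :
    IsPoissonBracket R (dualNumberBracket br) := by
  obtain ⟨⟨anti, linl, linr, leibl, leibr⟩, jac⟩ := h
  have addl (x y z : A) : br (x + y) z = br x z + br y z := by simpa using linl 1 x y z
  have addr (x y z : A) : br x (y + z) = br x y + br x z := by simpa using linr 1 x y z
  refine ⟨⟨fun x y => ?_, fun r x x' y => ?_, fun r x y y' => ?_, fun x x' y => ?_,
    fun x y y' => ?_⟩, fun x y z => ?_⟩ <;>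
  refine TrivSqZeroExt.ext ?_ ?_ <;>
  simp only [_root_.dualNumberBracket, TrivSqZeroExt.fst_add, TrivSqZeroExt.snd_add,
    TrivSqZeroExt.fst_inl, TrivSqZeroExt.snd_inl, TrivSqZeroExt.fst_inr, TrivSqZeroExt.snd_inr,
    TrivSqZeroExt.fst_neg, TrivSqZeroExt.snd_neg, TrivSqZeroExt.fst_smul,
    TrivSqZeroExt.snd_smul, TrivSqZeroExt.fst_mul, TrivSqZeroExt.snd_mul,
    TrivSqZeroExt.fst_zero, TrivSqZeroExt.snd_zero, add_zero, zero_add, linl, linr, addl, addr,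
    leibl, leibr, smul_eq_mul, MulOpposite.smul_eq_mul_unop, MulOpposite.unop_op, smul_add,
    smul_zero]
  · exact anti _ _
  · rw [anti x.fst, anti x.snd]; ring
  · abel
  · ring
  · ring
  · ring
  · exact jac _ _ _
  · linear_combination jac x.fst y.fst z.snd + jac x.fst y.snd z.fst + jac x.snd y.fst z.fst

/-- The `k[ε]`-linear extension of `t + ε w` to the dual numbers. -/
def dualNumberDeformation {A : Type*} [CommRing A] (t w : A → A) (u : DualNumber A) :
    DualNumber A :=
  TrivSqZeroExt.inl (t u.fst) + TrivSqZeroExt.inr (t u.snd + w u.fst)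

/-- The first-order part of the curvature of the connection with matrix `T + ε W`. -/
def firstOrderCurvature {A ι : Type*} [CommRing A] [Fintype ι]
    (br : A → A → A) (T W : ι → ι → A → A) (i j : ι) (f g : A) : A :=
  br (W i j f) g + br f (W i j g) - W i j (br f g) +
    ∑ p, (T i p f * W p j g - T i p g * W p j f + W i p f * T p j g - W i p g * T p j f)

section DualNumberCurvature

variable {A ι : Type*} [CommRing A] [Fintype ι] {br : A → A → A}

theorem fst_connectionCurvature_dualNumber (T W : ι → ι → A → A) (i j : ι)
    (u v : DualNumber A) :
    (connectionCurvature (dualNumberBracket br)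
      (fun i j => dualNumberDeformation (T i j) (W i j)) i j u v).fst =
      connectionCurvature br T i j u.fst v.fst := by
  simp [connectionCurvature, dualNumberBracket, dualNumberDeformation, TrivSqZeroExt.fst_sum]

theorem snd_connectionCurvature_dualNumber
    (addl : ∀ x y z, br (x + y) z = br x z + br y z)
    (addr : ∀ x y z, br x (y + z) = br x y + br x z)
    (T W : ι → ι → A → A) (hT : ∀ i j x y, T i j (x + y) = T i j x + T i j y) (i j : ι)
    (u v : DualNumber A) :
    (connectionCurvature (dualNumberBracket br)
      (fun i j => dualNumberDeformation (T i j) (W i j)) i j u v).snd =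
      firstOrderCurvature br T W i j u.fst v.fst +
        connectionCurvature br T i j u.fst v.snd + connectionCurvature br T i j u.snd v.fst := by
  simp only [connectionCurvature, firstOrderCurvature, dualNumberBracket, dualNumberDeformation,
    TrivSqZeroExt.snd_sum, TrivSqZeroExt.fst_add, TrivSqZeroExt.snd_add, TrivSqZeroExt.snd_sub, TrivSqZeroExt.fst_inl, TrivSqZeroExt.snd_inl, TrivSqZeroExt.fst_inr,
    TrivSqZeroExt.snd_inr, TrivSqZeroExt.snd_mul, add_zero, zero_add,
    smul_eq_mul, MulOpposite.smul_eq_mul_unop, MulOpposite.unop_op, addl, addr, hT,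
    mul_add, add_mul, Finset.sum_add_distrib, Finset.sum_sub_distrib]
  ring_nf

end DualNumberCurvature

/-- first-order deformations of a flat matrix connection. Extending the
bracket and the matrices of derivations `T`, `W` `k[ε]`-bilinearly to the dual numbers
`A[ε]`, the connection `({f,s}_F) i = {f, s i} + ∑ j (T i j + ε W i j) f · s j` on
`(A[ε])ⁿ` is flat iff both the flatness identity (a) for `T` and the first-order
identity (b) for `(T,W)` hold. -/
theorem first_order_deformation_flatness_criterion
    (k A : Type*) [Field k] [IsAlgClosed k] [CharZero k]
    [CommRing A] [Algebra k A]
    (br : A → A → A) (hbr : IsPoissonBracket k br)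
    (n : ℕ) (T W : Fin n → Fin n → Derivation k A A) :
    (IsFlatConnection
        (fun u v : DualNumber A =>
          TrivSqZeroExt.inl (br (TrivSqZeroExt.fst u) (TrivSqZeroExt.fst v)) +
            TrivSqZeroExt.inr (br (TrivSqZeroExt.fst u) (TrivSqZeroExt.snd v) +
              br (TrivSqZeroExt.snd u) (TrivSqZeroExt.fst v)))
        (fun (f : DualNumber A) (s : Fin n → DualNumber A) (i : Fin n) =>
          (TrivSqZeroExt.inl (br (TrivSqZeroExt.fst f) (TrivSqZeroExt.fst (s i))) +
             TrivSqZeroExt.inr (br (TrivSqZeroExt.fst f) (TrivSqZeroExt.snd (s i)) +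
               br (TrivSqZeroExt.snd f) (TrivSqZeroExt.fst (s i)))) +
            ∑ j, (TrivSqZeroExt.inl (T i j (TrivSqZeroExt.fst f)) +
                TrivSqZeroExt.inr (T i j (TrivSqZeroExt.snd f) +
                  W i j (TrivSqZeroExt.fst f))) * s j)) ↔
      ((∀ (i j : Fin n) (f g : A),
          br (T i j f) g + br f (T i j g) - T i j (br f g) +
            ∑ p, (T i p f * T p j g - T i p g * T p j f) = 0) ∧
       (∀ (i j : Fin n) (f g : A),
          br (W i j f) g + br f (W i j g) - W i j (br f g) +
            ∑ p, (T i p f * W p j g - T i p g * W p j f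
              + W i p f * T p j g - W i p g * T p j f) = 0)) := by
  have key := isFlatConnection_iff_connectionCurvature_eq_zero hbr.dualNumberBracket
    (fun i j => dualNumberDeformation (T i j) (W i j))
  refine key.trans ?_
  have addl (x y z : A) : br (x + y) z = br x z + br y z := by simpa using hbr.1.2.1 1 x y z
  have addr (x y z : A) : br x (y + z) = br x y + br x z := by simpa using hbr.1.2.2.1 1 x y z
  have hfst := fst_connectionCurvature_dualNumber (br := br)
    (fun i j => ⇑(T i j)) (fun i j => ⇑(W i j))
  have hsnd := snd_connectionCurvature_dualNumber addl addr
    (fun i j => ⇑(T i j)) (fun i j => ⇑(W i j)) (fun i j => map_add (T i j))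
  change _ ↔ (∀ i j f g, connectionCurvature br (fun i j => ⇑(T i j)) i j f g = 0) ∧
    ∀ i j f g, firstOrderCurvature br (fun i j => ⇑(T i j)) (fun i j => ⇑(W i j)) i j f g = 0
  constructor
  · intro h
    have hT (i j : Fin n) (f g : A) :
        connectionCurvature br (fun i j => ⇑(T i j)) i j f g = 0 := by
      simpa [h] using (hfst i j (TrivSqZeroExt.inl f) (TrivSqZeroExt.inl g)).symm
    refine ⟨hT, fun i j f g => ?_⟩
    simpa [h, hT] using (hsnd i j (TrivSqZeroExt.inl f) (TrivSqZeroExt.inl g)).symm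
  · rintro ⟨hT, hW⟩ i j u v
    refine TrivSqZeroExt.ext ?_ ?_
    · rw [hfst, hT, TrivSqZeroExt.fst_zero]
    · rw [hsnd, hT, hT, hW, add_zero, add_zero, TrivSqZeroExt.snd_zero]
end
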